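/- Fix β > -1. For nonnegative integers k, j, ∫_{-1}^{1} (d/dρ P_k^{(-1,β)}(ρ)) (d/dρ P_j^{(-1,β)}(ρ)) (1+ρ)^{β+1} dρ = δ_{kj} · 2^β (k+β)² / (2k+β) when k ≥ 1, and equals 0 when k = 0 or j = 0. -/

import Mathlib

open Real MeasureTheory Finset

noncomputable def jacobiP (n : ℕ) (a b : ℝ) (x : ℝ) : ℝ :=
  ∑ k ∈ Finset.range (n + 1),
    (ascPochhammer ℝ k).eval ((n : ℝ) + a + b + 1) *
      (ascPochhammer ℝ (n - k)).eval (a + (k : ℝ) + 1) /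
      ((k.factorial : ℝ) * ((n - k).factorial : ℝ)) * ((x - 1) / 2) ^ k

theorem ascPochhammer_eval_succ_left (n : ℕ) (x : ℝ) :
    (ascPochhammer ℝ (n + 1)).eval x = x * (ascPochhammer ℝ n).eval (x + 1) := by
  simp [ascPochhammer_succ_left]

theorem integral_one_sub_pow_mul_rpow (i : ℕ) {r : ℝ} (hr : 0 ≤ r) :
    ∫ u in (0:ℝ)..1, (1 - u) ^ i * u ^ r =
      (i.factorial : ℝ) / (ascPochhammer ℝ (i + 1)).eval (r + 1) := by
  induction i generalizing r with
  | zero =>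
    simp [integral_rpow (Or.inl (by linarith : -1 < r)), Real.zero_rpow (by linarith : r + 1 ≠ 0)]
  | succ i ih =>
    have hcont (s : ℝ) (hs : 0 ≤ s) :
        IntervalIntegrable (fun u : ℝ => (1 - u) ^ i * u ^ s) volume 0 1 :=
      (((continuous_const.sub continuous_id).pow i).mul
        (Real.continuous_rpow_const hs)).intervalIntegrable 0 1
    have hsplit : ∫ u in (0:ℝ)..1, (1 - u) ^ (i + 1) * u ^ r =
        ∫ u in (0:ℝ)..1, ((1 - u) ^ i * u ^ r - (1 - u) ^ i * u ^ (r + 1)) := by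
      refine intervalIntegral.integral_congr fun u hu => ?_
      rw [Set.uIcc_of_le zero_le_one] at hu
      simp only [Real.rpow_add_one' hu.1 (by linarith : r + 1 ≠ 0)]
      ring
    rw [hsplit, intervalIntegral.integral_sub (hcont r hr) (hcont (r + 1) (by linarith)),
      ih hr, ih (by linarith : 0 ≤ r + 1), ascPochhammer_eval_succ_left (i + 1) (r + 1),
      ascPochhammer_eval_succ_left i (r + 1), ascPochhammer_succ_eval i (r + 1 + 1)]
    have hpos : 0 < (ascPochhammer ℝ i).eval (r + 1 + 1) := ascPochhammer_pos _ _ (by linarith)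
    have h1 : r + 1 ≠ 0 := by linarith
    have h2 : r + 1 + 1 + (i : ℝ) ≠ 0 := by positivity
    rw [Nat.factorial_succ]
    push_cast
    field_simp
    ring

/-- The Chu-Vandermonde identity for a terminating hypergeometric series at one. -/
theorem sum_choose_mul_ascPochhammer_div (n : ℕ) (p : ℝ) {q : ℝ} (hq : 0 < q) :
    ∑ i ∈ range (n + 1), (-1) ^ i * (n.choose i : ℝ) *
        ((ascPochhammer ℝ i).eval p / (ascPochhammer ℝ i).eval q) =
      (ascPochhammer ℝ n).eval (q - p) / (ascPochhammer ℝ n).eval q := by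
  induction n generalizing p q with
  | zero => simp
  | succ n ih =>
    have hrec : ∑ i ∈ range (n + 1 + 1), (-1) ^ i * ((n + 1).choose i : ℝ) *
          ((ascPochhammer ℝ i).eval p / (ascPochhammer ℝ i).eval q) =
        ∑ i ∈ range (n + 1), (-1) ^ i * (n.choose i : ℝ) *
          ((ascPochhammer ℝ i).eval p / (ascPochhammer ℝ i).eval q) -
        p / q * ∑ i ∈ range (n + 1), (-1) ^ i * (n.choose i : ℝ) *
          ((ascPochhammer ℝ i).eval (p + 1) / (ascPochhammer ℝ i).eval (q + 1)) := by
      have hext : ∑ i ∈ range (n + 1), (-1) ^ i * (n.choose i : ℝ) *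
            ((ascPochhammer ℝ i).eval p / (ascPochhammer ℝ i).eval q) =
          ∑ i ∈ range (n + 1 + 1), (-1) ^ i * (n.choose i : ℝ) *
            ((ascPochhammer ℝ i).eval p / (ascPochhammer ℝ i).eval q) := by
        simp [sum_range_succ _ (n + 1)]
      rw [hext, sum_range_succ', sum_range_succ' _ (n + 1), mul_sum, add_sub_right_comm,
        ← sum_sub_distrib]
      congr 1
      · refine sum_congr rfl fun i _ => ?_
        rw [ascPochhammer_eval_succ_left, ascPochhammer_eval_succ_left, Nat.choose_succ_succ,
          mul_div_mul_comm]
        push_cast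
        ring
      · simp
    rw [hrec, ih p hq, ih (p + 1) (by linarith : 0 < q + 1), add_sub_add_right_eq_sub,
      ascPochhammer_succ_eval n (q - p)]
    have h1 := ascPochhammer_pos n q hq
    have h2 := ascPochhammer_pos n (q + 1) (by linarith)
    have h3 := ascPochhammer_succ_eval n q
    have h4 := ascPochhammer_eval_succ_left n q
    have h5 : q + (n : ℝ) ≠ 0 := by positivity
    have h6 : (ascPochhammer ℝ n).eval (q + 1) = (ascPochhammer ℝ n).eval q * (q + n) / q := by
      field_simp
      linarith
    rw [h3, h6]
    field_simp
    ring

/-- The Jacobi polynomial with parameters `(0, c)`, in the variable `u = (1 + x) / 2`. -/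
noncomputable def shiftedJacobi (c : ℝ) (n : ℕ) : Polynomial ℝ :=
  ∑ i ∈ range (n + 1), Polynomial.C ((n.choose i : ℝ) *
    (ascPochhammer ℝ i).eval (n + c + 1) / (i.factorial : ℝ)) * (Polynomial.X - 1) ^ i

theorem eval_shiftedJacobi (c : ℝ) (n : ℕ) (u : ℝ) :
    (shiftedJacobi c n).eval u = ∑ i ∈ range (n + 1), (n.choose i : ℝ) *
      (ascPochhammer ℝ i).eval (n + c + 1) / (i.factorial : ℝ) * (u - 1) ^ i := by
  simp [shiftedJacobi, Polynomial.eval_finsetSum]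

theorem natDegree_shiftedJacobi_le (c : ℝ) (n : ℕ) : (shiftedJacobi c n).natDegree ≤ n := by
  refine Polynomial.natDegree_sum_le_of_forall_le _ _ fun i hi => ?_
  refine (Polynomial.natDegree_C_mul_le _ _).trans ?_
  rw [← Polynomial.C_1, Polynomial.natDegree_pow, Polynomial.natDegree_X_sub_C, mul_one]
  exact Nat.lt_succ_iff.mp (mem_range.mp hi)

theorem coeff_shiftedJacobi_self (c : ℝ) (n : ℕ) : (shiftedJacobi c n).coeff n =
    (ascPochhammer ℝ n).eval (n + c + 1) / (n.factorial : ℝ) := by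
  have hdeg (i : ℕ) : ((Polynomial.X - 1 : Polynomial ℝ) ^ i).natDegree = i := by
    rw [← Polynomial.C_1, Polynomial.natDegree_pow, Polynomial.natDegree_X_sub_C, mul_one]
  have hmonic : ((Polynomial.X - 1 : Polynomial ℝ) ^ n).coeff n = 1 := by
    have h := ((Polynomial.monic_X_sub_C (1 : ℝ)).pow n).coeff_natDegree
    rwa [Polynomial.C_1, hdeg] at h
  rw [shiftedJacobi, Polynomial.finsetSum_coeff, sum_range_succ, sum_eq_zero]
  · simp [hmonic]
  · intro i hi
    rw [Polynomial.coeff_C_mul, Polynomial.coeff_eq_zero_of_natDegree_lt, mul_zero]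
    rw [hdeg]
    exact mem_range.mp hi

theorem intervalIntegrable_polynomial_mul_rpow (p : Polynomial ℝ) {r : ℝ} (hr : 0 ≤ r) :
    IntervalIntegrable (fun u : ℝ => p.eval u * u ^ r) volume 0 1 :=
  (p.continuous.mul (Real.continuous_rpow_const hr)).intervalIntegrable 0 1

theorem integral_shiftedJacobi_mul_rpow {c : ℝ} (hc : 0 ≤ c) (n m : ℕ) :
    ∫ u in (0:ℝ)..1, (shiftedJacobi c n).eval u * u ^ (c + m) =
      (ascPochhammer ℝ n).eval ((m : ℝ) + 1 - n) /
        (ascPochhammer ℝ (n + 1)).eval (c + m + 1) := by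
  have hcm : 0 ≤ c + m := by positivity
  have hmoment (i : ℕ) : ∫ u in (0:ℝ)..1, (n.choose i : ℝ) *
        (ascPochhammer ℝ i).eval (n + c + 1) / (i.factorial : ℝ) * (u - 1) ^ i * u ^ (c + m) =
      (-1) ^ i * (n.choose i : ℝ) * ((ascPochhammer ℝ i).eval (n + c + 1) /
        (ascPochhammer ℝ i).eval (c + m + 1 + 1)) / (c + m + 1) := by
    have hrw (u : ℝ) : (n.choose i : ℝ) * (ascPochhammer ℝ i).eval (n + c + 1) /
          (i.factorial : ℝ) * (u - 1) ^ i * u ^ (c + m) =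
        ((n.choose i : ℝ) * (ascPochhammer ℝ i).eval (n + c + 1) /
          (i.factorial : ℝ) * (-1) ^ i) * ((1 - u) ^ i * u ^ (c + m)) := by
      rw [← neg_sub 1 u, neg_pow (1 - u)]
      ring
    simp_rw [hrw]
    rw [intervalIntegral.integral_const_mul, integral_one_sub_pow_mul_rpow i hcm,
      ascPochhammer_eval_succ_left]
    have h1 := ascPochhammer_pos i (c + m + 1 + 1) (by linarith)
    have h2 : c + m + 1 ≠ 0 := by positivity
    have h3 : (i.factorial : ℝ) ≠ 0 := by positivity
    field_simp
  simp_rw [eval_shiftedJacobi, sum_mul]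
  rw [intervalIntegral.integral_finsetSum]
  · simp_rw [hmoment]
    rw [← sum_div, sum_choose_mul_ascPochhammer_div n _ (by linarith : 0 < c + m + 1 + 1),
      ascPochhammer_eval_succ_left, div_div, mul_comm (c + m + 1)]
    congr 2
    ring
  · intro i _
    exact Continuous.intervalIntegrable
      (by have := Real.continuous_rpow_const hcm; fun_prop) 0 1

theorem integral_shiftedJacobi_mul_polynomial {c : ℝ} (hc : 0 < c) (n : ℕ)
    {p : Polynomial ℝ} (hp : p.natDegree ≤ n) :
    ∫ u in (0:ℝ)..1, (shiftedJacobi c n).eval u * p.eval u * u ^ c =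
      p.coeff n * ((n.factorial : ℝ) / (ascPochhammer ℝ (n + 1)).eval (c + n + 1)) := by
  have hexpand : ∫ u in (0:ℝ)..1, (shiftedJacobi c n).eval u * p.eval u * u ^ c =
      ∫ u in (0:ℝ)..1, ∑ m ∈ range (n + 1),
        p.coeff m * ((shiftedJacobi c n).eval u * u ^ (c + m)) := by
    refine intervalIntegral.integral_congr fun u hu => ?_
    rw [Set.uIcc_of_le zero_le_one] at hu
    rw [Polynomial.eval_eq_sum_range' (Nat.lt_succ_of_le hp), mul_sum, sum_mul]
    refine sum_congr rfl fun m _ => ?_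
    rw [Real.rpow_add_natCast' hu.1 (by positivity)]
    ring
  rw [hexpand, intervalIntegral.integral_finsetSum fun m _ =>
    (intervalIntegrable_polynomial_mul_rpow _ (by positivity)).const_mul _]
  simp_rw [intervalIntegral.integral_const_mul, integral_shiftedJacobi_mul_rpow hc.le]
  rw [sum_range_succ, sum_eq_zero, zero_add, add_sub_cancel_left, ascPochhammer_eval_one]
  intro m hm
  obtain ⟨d, rfl⟩ := Nat.exists_eq_add_of_lt (mem_range.mp hm)
  have hroot : (ascPochhammer ℝ (m + d + 1)).eval ((m : ℝ) + 1 - ((m + d + 1 : ℕ) : ℝ)) = 0 := by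
    rw [show (m : ℝ) + 1 - ((m + d + 1 : ℕ) : ℝ) = -(d : ℝ) by push_cast; ring]
    exact ascPochhammer_eval_neg_coe_nat_of_lt (by omega)
  rw [hroot, zero_div, mul_zero]

theorem integral_shiftedJacobi_mul_shiftedJacobi {c : ℝ} (hc : 0 < c) (n m : ℕ) :
    ∫ u in (0:ℝ)..1, (shiftedJacobi c n).eval u * (shiftedJacobi c m).eval u * u ^ c =
      if n = m then 1 / (2 * (n : ℝ) + c + 1) else 0 := by
  have hlt {n m : ℕ} (h : m < n) :
      ∫ u in (0:ℝ)..1, (shiftedJacobi c n).eval u * (shiftedJacobi c m).eval u * u ^ c = 0 := by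
    have hdeg := natDegree_shiftedJacobi_le c m
    rw [integral_shiftedJacobi_mul_polynomial hc n (hdeg.trans h.le),
      Polynomial.coeff_eq_zero_of_natDegree_lt (hdeg.trans_lt h), zero_mul]
  rcases lt_trichotomy n m with h | rfl | h
  · rw [if_neg h.ne]
    simp_rw [mul_comm ((shiftedJacobi c n).eval _)]
    exact hlt h
  · rw [if_pos rfl, integral_shiftedJacobi_mul_polynomial hc n (natDegree_shiftedJacobi_le c n),
      coeff_shiftedJacobi_self, ascPochhammer_succ_eval, add_comm c (n : ℝ)]
    have h1 := ascPochhammer_pos n (n + c + 1) (by positivity)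
    have h2 : (n : ℝ) + c + 1 + n ≠ 0 := by positivity
    have h3 : 2 * (n : ℝ) + c + 1 ≠ 0 := by positivity
    have h4 : (n.factorial : ℝ) ≠ 0 := by positivity
    field_simp
    ring
  · rw [if_neg h.ne', hlt h]

theorem deriv_jacobiP_zero (a b x : ℝ) : deriv (fun y => jacobiP 0 a b y) x = 0 := by
  simp [jacobiP]

theorem deriv_jacobiP_succ (b : ℝ) (n : ℕ) (x : ℝ) :
    deriv (fun y => jacobiP (n + 1) (-1) b y) x =
      ((n : ℝ) + 1 + b) / 2 * (shiftedJacobi (b + 1) n).eval ((1 + x) / 2) := by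
  have hpow (i : ℕ) : HasDerivAt (fun y : ℝ => ((y - 1) / 2) ^ i)
      (i * ((x - 1) / 2) ^ (i - 1) * (1 / 2)) x :=
    (((hasDerivAt_id x).sub_const 1).div_const 2).pow i
  have hderiv := HasDerivAt.fun_sum fun i (_ : i ∈ range (n + 1 + 1)) =>
    (hpow i).const_mul ((ascPochhammer ℝ i).eval (((n + 1 : ℕ) : ℝ) + -1 + b + 1) *
      (ascPochhammer ℝ (n + 1 - i)).eval (-1 + (i : ℝ) + 1) /
      ((i.factorial : ℝ) * ((n + 1 - i).factorial : ℝ)))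
  refine hderiv.deriv.trans ?_
  rw [sum_range_succ', eval_shiftedJacobi, mul_sum]
  simp only [Nat.cast_zero, zero_mul, mul_zero, add_zero]
  refine sum_congr rfl fun i hi => ?_
  obtain ⟨d, rfl⟩ := Nat.exists_eq_add_of_le (Nat.lt_succ_iff.mp (mem_range.mp hi))
  have hasc : (i.factorial : ℝ) * (ascPochhammer ℝ d).eval ((i : ℝ) + 1) =
      ((i + d).factorial : ℝ) := by
    exact_mod_cast factorial_mul_ascPochhammer ℝ i d
  have hchoose : ((i + d).choose i : ℝ) * (i.factorial : ℝ) * (d.factorial : ℝ) =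
      ((i + d).factorial : ℝ) := by
    rw [Nat.choose_symm_add]
    exact_mod_cast Nat.add_choose_mul_factorial_mul_factorial i d
  have hi : (i.factorial : ℝ) ≠ 0 := by positivity
  have hd : (d.factorial : ℝ) ≠ 0 := by positivity
  have hasc' : (ascPochhammer ℝ d).eval ((i : ℝ) + 1) =
      ((i + d).choose i : ℝ) * (d.factorial : ℝ) := by
    apply mul_left_cancel₀ hi
    linarith
  rw [show i + d + 1 - (i + 1) = d by omega, Nat.add_sub_cancel, ascPochhammer_eval_succ_left,
    Nat.factorial_succ]
  push_cast
  rw [show (-1 : ℝ) + ((i : ℝ) + 1) + 1 = i + 1 by ring, hasc',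
    show (i : ℝ) + d + 1 + -1 + b + 1 = i + d + 1 + b by ring,
    show (i : ℝ) + d + 1 + b + 1 = i + d + (b + 1) + 1 by ring,
    show (1 + x) / 2 - 1 = (x - 1) / 2 by ring]
  field_simp

theorem integral_shiftedJacobi_comp_mul_rpow {c : ℝ} (hc : 0 < c) (n m : ℕ) :
    ∫ x in (-1:ℝ)..1, (shiftedJacobi c n).eval ((1 + x) / 2) *
        (shiftedJacobi c m).eval ((1 + x) / 2) * (1 + x) ^ c =
      if n = m then 2 ^ (c + 1) / (2 * (n : ℝ) + c + 1) else 0 := by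
  have hsub := intervalIntegral.mul_integral_comp_mul_sub (a := 0) (b := 1)
    (f := fun x : ℝ => (shiftedJacobi c n).eval ((1 + x) / 2) *
      (shiftedJacobi c m).eval ((1 + x) / 2) * (1 + x) ^ c) 2 1
  have hcongr : ∫ u in (0:ℝ)..1, (shiftedJacobi c n).eval ((1 + (2 * u - 1)) / 2) *
        (shiftedJacobi c m).eval ((1 + (2 * u - 1)) / 2) * (1 + (2 * u - 1)) ^ c =
      ∫ u in (0:ℝ)..1, 2 ^ c *
        ((shiftedJacobi c n).eval u * (shiftedJacobi c m).eval u * u ^ c) := by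
    refine intervalIntegral.integral_congr fun u hu => ?_
    rw [Set.uIcc_of_le zero_le_one] at hu
    simp only [add_sub_cancel]
    rw [mul_div_cancel_left₀ u two_ne_zero, Real.mul_rpow zero_le_two hu.1]
    ring
  rw [hcongr, intervalIntegral.integral_const_mul,
    integral_shiftedJacobi_mul_shiftedJacobi hc] at hsub
  norm_num at hsub
  rw [← hsub, Real.rpow_add_one two_ne_zero]
  split_ifs <;> ring

theorem stmt12 (b : ℝ) (hb : -1 < b) (k j : ℕ)
    (I : ℝ)
    (hI : I = ∫ x in (-1:ℝ)..1,
        deriv (fun y => jacobiP k (-1) b y) x * deriv (fun y => jacobiP j (-1) b y) x *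
          (1 + x) ^ (b + 1)) :
    (1 ≤ k → I = if k = j then 2 ^ b * ((k : ℝ) + b) ^ 2 / (2 * (k : ℝ) + b) else 0) ∧
    (k = 0 ∨ j = 0 → I = 0) := by
  subst hI
  refine ⟨fun hk => ?_, ?_⟩
  · obtain ⟨n, rfl⟩ := Nat.exists_eq_add_of_le' hk
    rcases j with _ | m
    · simp [deriv_jacobiP_zero]
    have hfactor (x : ℝ) : deriv (fun y => jacobiP (n + 1) (-1) b y) x *
          deriv (fun y => jacobiP (m + 1) (-1) b y) x * (1 + x) ^ (b + 1) =
        (((n : ℝ) + 1 + b) / 2 * (((m : ℝ) + 1 + b) / 2)) *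
          ((shiftedJacobi (b + 1) n).eval ((1 + x) / 2) *
            (shiftedJacobi (b + 1) m).eval ((1 + x) / 2) * (1 + x) ^ (b + 1)) := by
      rw [deriv_jacobiP_succ, deriv_jacobiP_succ]
      ring
    simp_rw [hfactor]
    rw [intervalIntegral.integral_const_mul,
      integral_shiftedJacobi_comp_mul_rpow (by linarith : 0 < b + 1)]
    by_cases h : n = m
    · subst h
      rw [if_pos rfl, if_pos rfl, Real.rpow_add_one two_ne_zero, Real.rpow_add_one two_ne_zero]
      push_cast
      rw [show 2 * (n : ℝ) + (b + 1) + 1 = 2 * (n + 1) + b by ring]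
      ring
    · rw [if_neg h, if_neg (by omega), mul_zero]
  · rintro (rfl | rfl) <;> simp [deriv_jacobiP_zero]
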